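/- arXiv:2507.00941 — 2 statements merged into one kernel-verified Lean document; each statement's English description precedes it below -/
import Mathlib

section
/- For every finite connected simple graph G and every non-negative integer l, the eventual seeing number with l-visibility cops equals the l-reach number: evcapt'_l(G) = reach_l(G). -/
open Classical

/-- A cop at `c` sees the vertex `v` when `v` is within distance `l` of `c`. -/
def inSight {V : Type} (G : SimpleGraph V) (l : ℕ) (c v : V) : Prop :=
  G.Reachable c v ∧ G.dist c v ≤ l

/-- A legal robber trajectory: at each turn the robber stays put or moves
to an adjacent vertex. -/
def LegalRobber {V : Type} (G : SimpleGraph V) (r : ℕ → V) : Prop :=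
  ∀ t, r (t + 1) = r t ∨ G.Adj (r t) (r (t + 1))

/-- A legal sequence of cop positions: at each turn every cop stays put or
moves to an adjacent vertex. -/
def LegalCopPath {V : Type} (G : SimpleGraph V) {k : ℕ} (P : ℕ → Fin k → V) : Prop :=
  ∀ t i, P (t + 1) i = P t i ∨ G.Adj (P t i) (P (t + 1) i)

/-- The observation made by `l`-visibility cops at positions `P` when the robber
is at `rv`: they see the robber exactly when he is within distance `l` of some cop. -/
noncomputable def visObs {V : Type} (G : SimpleGraph V) (l : ℕ) {k : ℕ}
    (P : Fin k → V) (rv : V) : Option V :=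
  if ∃ i, inSight G l (P i) rv then some rv else none

/-- The play of the `l`-visibility game: given initial cop positions `init`, a cop
strategy `σ` (a function of the history of observations only), and a robber
trajectory `r`, this returns the cop positions after `t` cop moves together with the
history of observations made so far. -/
noncomputable def visPlay {V : Type} (G : SimpleGraph V) (l : ℕ) {k : ℕ}
    (init : Fin k → V) (σ : List (Option V) → Fin k → V) (r : ℕ → V) :
    ℕ → (Fin k → V) × List (Option V)
  | 0 => (init, [])
  | t + 1 =>
    let prev := visPlay G l init σ r t
    let h := prev.2 ++ [visObs G l prev.1 (r t)]
    (σ h, h)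

/-- Cop positions after `t` cop moves in the `l`-visibility game. -/
noncomputable def visPos {V : Type} (G : SimpleGraph V) (l : ℕ) {k : ℕ}
    (init : Fin k → V) (σ : List (Option V) → Fin k → V) (r : ℕ → V) (t : ℕ) :
    Fin k → V :=
  (visPlay G l init σ r t).1

/-- `k` cops with visibility `l` can guarantee capturing the robber on `G`:
there are initial positions and a strategy (depending only on the cops' observations)
whose moves are always legal and such that, against every legal robber trajectory,
some cop eventually occupies the robber's vertex. -/
def VisCopsCapture {V : Type} (G : SimpleGraph V) (l k : ℕ) : Prop :=
  ∃ (init : Fin k → V) (σ : List (Option V) → Fin k → V),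
    ∀ r : ℕ → V, LegalRobber G r →
      LegalCopPath G (visPos G l init σ r) ∧
      ∃ t i, visPos G l init σ r t i = r t ∨ visPos G l init σ r (t + 1) i = r t

/-- `k` cops with visibility `l` can guarantee seeing the robber on `G`. -/
def VisCopsSee {V : Type} (G : SimpleGraph V) (l k : ℕ) : Prop :=
  ∃ (init : Fin k → V) (σ : List (Option V) → Fin k → V),
    ∀ r : ℕ → V, LegalRobber G r →
      LegalCopPath G (visPos G l init σ r) ∧
      ∃ t i, inSight G l (visPos G l init σ r t i) (r t) ∨
        inSight G l (visPos G l init σ r (t + 1) i) (r t)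

/-- The `l`-visibility capture number `cop_l(G)`. -/
noncomputable def visCaptureNum {V : Type} (G : SimpleGraph V) (l : ℕ) : ℕ :=
  sInf {k | VisCopsCapture G l k}

/-- The `l`-visibility seeing number `cop'_l(G)`. -/
noncomputable def visSeeNum {V : Type} (G : SimpleGraph V) (l : ℕ) : ℕ :=
  sInf {k | VisCopsSee G l k}

/-- Cop positions in the classical (full-information) game: the strategy `σ` may
depend on the whole history of robber positions. -/
def fullPos {V : Type} {k : ℕ} (init : Fin k → V) (σ : List V → Fin k → V)
    (r : ℕ → V) : ℕ → Fin k → V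
  | 0 => init
  | t + 1 => σ (List.ofFn fun j : Fin (t + 1) => r j.1)

/-- `k` cops with unrestricted visibility can guarantee capturing the robber on `G`. -/
def CopsCatch {V : Type} (G : SimpleGraph V) (k : ℕ) : Prop :=
  ∃ (init : Fin k → V) (σ : List V → Fin k → V),
    ∀ r : ℕ → V, LegalRobber G r →
      LegalCopPath G (fullPos init σ r) ∧
      ∃ t i, fullPos init σ r t i = r t ∨ fullPos init σ r (t + 1) i = r t

/-- The classical cop number `cop(G)`. -/
noncomputable def copNum {V : Type} (G : SimpleGraph V) : ℕ :=
  sInf {k | CopsCatch G k}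

/-- `k` cops with unrestricted visibility can guarantee getting within
distance `l` of the robber on `G`. -/
def CopsReach {V : Type} (G : SimpleGraph V) (l k : ℕ) : Prop :=
  ∃ (init : Fin k → V) (σ : List V → Fin k → V),
    ∀ r : ℕ → V, LegalRobber G r →
      LegalCopPath G (fullPos init σ r) ∧
      ∃ t i, inSight G l (fullPos init σ r t i) (r t) ∨
        inSight G l (fullPos init σ r (t + 1) i) (r t)

/-- The `l`-reach number `reach_l(G)`. -/
noncomputable def reachNum {V : Type} (G : SimpleGraph V) (l : ℕ) : ℕ :=
  sInf {k | CopsReach G l k}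
/-- The number of vertices in the closed neighbourhood of `v`. -/
noncomputable def closedNbhdCard {V : Type} (G : SimpleGraph V) (v : V) : ℕ :=
  {u | u = v ∨ G.Adj v u}.ncard

/-- The probability that `k` cops standing at positions `P`, each independently
choosing its next vertex uniformly at random from its closed neighbourhood, end up
at positions `Q` after one simultaneous random step. -/
noncomputable def stepWeight {V : Type} (G : SimpleGraph V) {k : ℕ}
    (P Q : Fin k → V) : ℝ :=
  ∏ i, if Q i = P i ∨ G.Adj (P i) (Q i) then (1 : ℝ) / (closedNbhdCard G (P i)) else 0

/-- A robber strategy against randomly moving cops: a function assigning to each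
(nonempty) history of cop position-tuples the robber's current position, so that the
robber reacts with full knowledge of all positions.  It is legal if after each new
cop move the robber stays put or moves to an adjacent vertex. -/
def LegalRobberStrat {V : Type} (G : SimpleGraph V) {k : ℕ}
    (ρ : List (Fin k → V) → V) : Prop :=
  ∀ (h : List (Fin k → V)) (Q : Fin k → V), h ≠ [] →
    ρ (h ++ [Q]) = ρ h ∨ G.Adj (ρ h) (ρ (h ++ [Q]))

/-- Given a `hit` relation (between a cop's vertex and the robber's vertex), the
cops at positions `P`, arrived at after the history `prev`, hit the robber playing
the strategy `ρ` right now: either some cop hits the robber's position after the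
robber's answering move, or some cop has just moved so as to hit the robber's
previous position. -/
def HitNow {V : Type} (hit : V → V → Prop) {k : ℕ} (ρ : List (Fin k → V) → V)
    (prev : List (Fin k → V)) (P : Fin k → V) : Prop :=
  (∃ i, hit (P i) (ρ (prev ++ [P]))) ∨ (prev ≠ [] ∧ ∃ i, hit (P i) (ρ prev))

/-- The probability that randomly moving cops, currently at positions `P` reached
via the history `prev`, fail to hit the robber playing strategy `ρ` within the next
`n` random steps. -/
noncomputable def survProb {V : Type} [Fintype V] (G : SimpleGraph V)
    (hit : V → V → Prop) {k : ℕ} (ρ : List (Fin k → V) → V) :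
    ℕ → List (Fin k → V) → (Fin k → V) → ℝ
  | 0, prev, P => if HitNow hit ρ prev P then 0 else 1
  | n + 1, prev, P =>
    if HitNow hit ρ prev P then 0
    else ∑ Q : Fin k → V, stepWeight G P Q * survProb G hit ρ n (prev ++ [P]) Q

/-- `k` cops moving uniformly at random hit the robber (in the sense of the relation
`hit`) with probability `1`, whatever legal strategy the robber uses: for suitable
initial positions, the probability of surviving `n` steps tends to `0`. -/
def AlmostSurelyHits {V : Type} [Fintype V] (G : SimpleGraph V)
    (hit : V → V → Prop) (k : ℕ) : Prop :=
  ∃ init : Fin k → V, ∀ ρ : List (Fin k → V) → V, LegalRobberStrat G ρ →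
    Filter.Tendsto (fun n => survProb G hit ρ n [] init) Filter.atTop (nhds 0)

/-- The eventual capture number `evcapt_l(G)`: the minimum number of `l`-visibility
cops, each moving uniformly at random over its closed neighbourhood at every turn,
that eventually occupy the robber's vertex with probability `1`.  (As capture means
occupying the robber's vertex, the visibility `l` plays no role.) -/
noncomputable def evCaptureNum {V : Type} [Fintype V] (G : SimpleGraph V)
    (l : ℕ) : ℕ :=
  sInf {k | AlmostSurelyHits G (fun c rv => c = rv) k}

/-- The eventual seeing number `evcapt'_l(G)`: the minimum number of `l`-visibility
cops, each moving uniformly at random over its closed neighbourhood at every turn,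
that eventually come within distance `l` of the robber with probability `1`. -/
noncomputable def evSeeNum {V : Type} [Fintype V] (G : SimpleGraph V) (l : ℕ) : ℕ :=
  sInf {k | AlmostSurelyHits G (inSight G l) k}

/-- Every cop stays put or moves to an adjacent vertex between `P` and `Q`. -/
def CopStep {V : Type} (G : SimpleGraph V) {k : ℕ} (P Q : Fin k → V) : Prop :=
  ∀ i, Q i = P i ∨ G.Adj (P i) (Q i)

/-- The cops at `P`, about to move, can hit the robber at `v` within `n` of their moves. -/
def WinsIn {V : Type} (G : SimpleGraph V) (hit : V → V → Prop) {k : ℕ} :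
    ℕ → (Fin k → V) → V → Prop
  | 0, P, v => ∃ i, hit (P i) v
  | n + 1, P, v => (∃ i, hit (P i) v) ∨ ∃ Q, CopStep G P Q ∧
      ((∃ i, hit (Q i) v) ∨ ∀ w, (w = v ∨ G.Adj v w) → WinsIn G hit n Q w)

/-- The cops at `P`, about to move, can hit the robber at `v` in boundedly many moves. -/
def Wins {V : Type} (G : SimpleGraph V) (hit : V → V → Prop) {k : ℕ}
    (P : Fin k → V) (v : V) : Prop :=
  ∃ n, WinsIn G hit n P v

section Game

variable {V : Type} {G : SimpleGraph V} {hit : V → V → Prop} {k : ℕ}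

lemma winsIn_of_hit {P : Fin k → V} {v : V} (h : ∃ i, hit (P i) v) (n : ℕ) :
    WinsIn G hit n P v := by
  cases n with
  | zero => exact h
  | succ n => exact Or.inl h

lemma winsIn_succ {n : ℕ} : ∀ {P : Fin k → V} {v : V},
    WinsIn G hit n P v → WinsIn G hit (n + 1) P v := by
  induction n with
  | zero => exact fun h => Or.inl h
  | succ n ih =>
    rintro P v (h | ⟨Q, hQ, h | h⟩)
    · exact Or.inl h
    · exact Or.inr ⟨Q, hQ, Or.inl h⟩
    · exact Or.inr ⟨Q, hQ, Or.inr fun w hw => ih (h w hw)⟩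

lemma winsIn_mono {m n : ℕ} (hmn : m ≤ n) {P : Fin k → V} {v : V}
    (h : WinsIn G hit m P v) : WinsIn G hit n P v := by
  induction hmn with
  | refl => exact h
  | step _ ih => exact winsIn_succ ih

/-- On finitely many states a common bound on the number of moves exists. -/
lemma exists_uniform_winsIn {ι : Type} [Finite ι] (P : ι → Fin k → V) (v : ι → V)
    (h : ∀ a, Wins G hit (P a) (v a)) : ∃ n, ∀ a, WinsIn G hit n (P a) (v a) := by
  cases nonempty_fintype ι
  choose f hf using h
  exact ⟨Finset.univ.sup f, fun a => winsIn_mono (Finset.le_sup (Finset.mem_univ a)) (hf a)⟩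

lemma wins_of_copStep [Finite V] {P Q : Fin k → V} {v : V} (hQ : CopStep G P Q)
    (h : ∀ w, (w = v ∨ G.Adj v w) → Wins G hit Q w) : Wins G hit P v := by
  obtain ⟨n, hn⟩ := exists_uniform_winsIn
    (fun _ : {w // w = v ∨ G.Adj v w} => Q) (fun w => w.1) (fun w => h w.1 w.2)
  exact ⟨n + 1, Or.inr ⟨Q, hQ, Or.inr fun w hw => hn ⟨w, hw⟩⟩⟩

lemma not_hit_of_copStep {P Q : Fin k → V} {v : V} (h : ¬ Wins G hit P v)
    (hQ : CopStep G P Q) : ¬ ∃ i, hit (Q i) v :=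
  fun hh => h ⟨1, Or.inr ⟨Q, hQ, Or.inl hh⟩⟩

/-- An optimal memoryless move for the cops. -/
lemma exists_copStep_winsIn (P : Fin k → V) (v : V) : ∃ Q, CopStep G P Q ∧
    ∀ n, WinsIn G hit (n + 1) P v → (∃ i, hit (P i) v) ∨ (∃ i, hit (Q i) v) ∨
      ∀ w, (w = v ∨ G.Adj v w) → WinsIn G hit n Q w := by
  by_cases h : ∃ n, WinsIn G hit n P v
  · have hmin := fun m => Nat.find_min' h (m := m)
    have hspec := Nat.find_spec h
    cases hn : Nat.find h with
    | zero =>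
      rw [hn] at hspec
      exact ⟨P, fun _ => Or.inl rfl, fun _ _ => Or.inl hspec⟩
    | succ m =>
      rw [hn] at hspec
      rcases hspec with h1 | ⟨Q, hQ, h1⟩
      · exact ⟨P, fun _ => Or.inl rfl, fun _ _ => Or.inl h1⟩
      · refine ⟨Q, hQ, fun n hw => Or.inr (h1.imp_right fun h1 w hvw => ?_)⟩
        have := hmin _ hw
        exact winsIn_mono (by omega) (h1 w hvw)
  · exact ⟨P, fun _ => Or.inl rfl, fun n hw => absurd ⟨_, hw⟩ h⟩

/-- A memoryless evasion rule: answer the cops' move to `Q` by a move to a position that is not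
winning for the cops, whenever there is one. -/
lemma exists_evasion (G : SimpleGraph V) (hit : V → V → Prop) (k : ℕ) [Finite V] :
    ∃ g : V → (Fin k → V) → V, (∀ v Q, g v Q = v ∨ G.Adj v (g v Q)) ∧
      ∀ P Q v, ¬ Wins G hit P v → CopStep G P Q → ¬ Wins G hit Q (g v Q) := by
  have h : ∀ (v : V) (Q : Fin k → V), ∃ w, (w = v ∨ G.Adj v w) ∧
      ∀ P, ¬ Wins G hit P v → CopStep G P Q → ¬ Wins G hit Q w := by
    intro v Q
    by_cases h : ∃ w, (w = v ∨ G.Adj v w) ∧ ¬ Wins G hit Q w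
    · obtain ⟨w, hw, hn⟩ := h
      exact ⟨w, hw, fun _ _ _ => hn⟩
    · push Not at h
      exact ⟨v, Or.inl rfl, fun P hP hQ => absurd (wins_of_copStep hQ h) hP⟩
  choose g hg1 hg2 using h
  exact ⟨g, hg1, fun P Q v => hg2 v Q P⟩

/-- If the cops win from one placement against every robber placement, they win from all. -/
lemma wins_of_forall_wins [Finite V] (hG : G.Connected) {init : Fin k → V}
    (h : ∀ v, Wins G hit init v) (P : Fin k → V) (v : V) : Wins G hit P v := by
  have key : ∀ (n : ℕ) (P : Fin k → V), (∀ i, G.dist (P i) (init i) ≤ n) →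
      ∀ v, Wins G hit P v := by
    intro n
    induction n with
    | zero =>
      intro P hP v
      have : P = init := funext fun i => (hG.dist_eq_zero_iff).1 (Nat.le_zero.1 (hP i))
      exact this ▸ h v
    | succ n ih =>
      intro P hP v
      have step : ∀ i, ∃ u, (u = P i ∨ G.Adj (P i) u) ∧ G.dist u (init i) ≤ n := by
        intro i
        obtain ⟨p, hp⟩ := hG.exists_walk_length_eq_dist (P i) (init i)
        have hi := hP i
        rw [← hp] at hi
        generalize P i = a, init i = b at p hi
        cases p with
        | nil => exact ⟨a, Or.inl rfl, by simp⟩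
        | cons hadj q =>
          rw [SimpleGraph.Walk.length_cons] at hi
          exact ⟨_, Or.inr hadj, (SimpleGraph.dist_le q).trans (by omega)⟩
      choose Q hQ1 hQ2 using step
      exact wins_of_copStep hQ1 fun w _ => ih Q hQ2 w
  exact key _ P (fun i => Finset.le_sup (f := fun i => G.dist (P i) (init i))
    (Finset.mem_univ i)) v

end Game

section FullInformation

variable {V : Type} {G : SimpleGraph V} {l k : ℕ}

lemma copsReach_of_forall_wins {init : Fin k → V}
    (h : ∀ v, Wins G (inSight G l) init v) : CopsReach G l k := by
  choose f hf1 hf2 using exists_copStep_winsIn (G := G) (hit := inSight G l) (k := k)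
  refine ⟨init, List.foldl f init, fun r hr => ?_⟩
  set P := fullPos init (List.foldl f init) r with hP
  have hstep : ∀ t, P (t + 1) = f (P t) (r t) := by
    intro t
    cases t with
    | zero => simp [hP, fullPos]
    | succ t =>
      simp only [hP, fullPos]
      rw [List.ofFn_succ' (n := t + 1)]
      simp
  refine ⟨fun t => hstep t ▸ hf1 (P t) (r t), ?_⟩
  have key : ∀ n t, WinsIn G (inSight G l) n (P t) (r t) →
      ∃ t i, inSight G l (P t i) (r t) ∨ inSight G l (P (t + 1) i) (r t) := by
    intro n
    induction n with
    | zero => exact fun t ⟨i, hi⟩ => ⟨t, i, Or.inl hi⟩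
    | succ n ih =>
      intro t hw
      rcases hf2 _ _ n hw with ⟨i, hi⟩ | ⟨i, hi⟩ | h1
      · exact ⟨t, i, Or.inl hi⟩
      · exact ⟨t, i, Or.inr (by rwa [hstep])⟩
      · exact ih (t + 1) (by rw [hstep]; exact h1 _ (hr t))
  obtain ⟨n, hn⟩ := h (r 0)
  exact key n 0 hn

lemma exists_forall_wins_of_copsReach [Finite V] (h : CopsReach G l k) :
    ∃ init : Fin k → V, ∀ v, Wins G (inSight G l) init v := by
  obtain ⟨init, σ, hσ⟩ := h
  refine ⟨init, fun v => by_contra fun hv => ?_⟩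
  obtain ⟨g, hg1, hg2⟩ := exists_evasion G (inSight G l) k
  let st : ℕ → V × List V := fun t => Nat.rec (v, [v])
    (fun _ s => (g s.1 (σ s.2), s.2 ++ [g s.1 (σ s.2)])) t
  let r : ℕ → V := fun t => (st t).1
  have hst : ∀ t, (st t).2 = List.ofFn fun j : Fin (t + 1) => r j.1 := by
    intro t
    induction t with
    | zero => simp [r, st]
    | succ t ih =>
      rw [List.ofFn_succ' (n := t + 1)]
      simp only [Fin.val_castSucc, ← ih, Fin.val_last, List.concat_eq_append]
      rfl
  have hrs : ∀ t, r (t + 1) = g (r t) (fullPos init σ r (t + 1)) := by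
    intro t
    simp only [fullPos, ← hst]
    rfl
  have hr : LegalRobber G r := fun t => hrs t ▸ hg1 _ _
  obtain ⟨hlegal, t, i, hi⟩ := hσ r hr
  have hnot : ∀ t, ¬ Wins G (inSight G l) (fullPos init σ r t) (r t) := by
    intro t
    induction t with
    | zero => exact hv
    | succ t ih => rw [hrs]; exact hg2 _ _ _ ih (hlegal t)
  rcases hi with hi | hi
  · exact hnot t ⟨0, i, hi⟩
  · exact not_hit_of_copStep (hnot t) (hlegal t) ⟨i, hi⟩

end FullInformation

section Random

lemma stepWeight_nonneg {V : Type} {G : SimpleGraph V} {k : ℕ} (P Q : Fin k → V) :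
    0 ≤ stepWeight G P Q :=
  Finset.prod_nonneg fun i _ => by split_ifs <;> positivity

lemma stepWeight_eq_zero {V : Type} {G : SimpleGraph V} {k : ℕ} {P Q : Fin k → V}
    (h : ¬ CopStep G P Q) : stepWeight G P Q = 0 := by
  simp only [CopStep, not_forall] at h
  obtain ⟨i, hi⟩ := h
  exact Finset.prod_eq_zero (Finset.mem_univ i) (if_neg hi)

variable {V : Type} [Fintype V] {G : SimpleGraph V} {hit : V → V → Prop} {k : ℕ}

lemma closedNbhdCard_pos (v : V) : 0 < closedNbhdCard G v :=
  (Set.ncard_pos (Set.toFinite _)).2 ⟨v, Or.inl rfl⟩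

lemma stepWeight_pos {P Q : Fin k → V} (h : CopStep G P Q) : 0 < stepWeight G P Q :=
  Finset.prod_pos fun i _ => by
    rw [if_pos (h i)]
    have := closedNbhdCard_pos (G := G) (P i)
    positivity

lemma sum_stepWeight (P : Fin k → V) : ∑ Q, stepWeight G P Q = 1 := by
  unfold stepWeight
  rw [← Fintype.prod_sum (fun i u => if u = P i ∨ G.Adj (P i) u then
    (1 : ℝ) / (closedNbhdCard G (P i)) else 0)]
  refine Finset.prod_eq_one fun i _ => ?_
  rw [← Finset.sum_filter, Finset.sum_const, nsmul_eq_mul]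
  have hc : (Finset.univ.filter fun u => u = P i ∨ G.Adj (P i) u).card =
      closedNbhdCard G (P i) := by
    rw [closedNbhdCard, ← Set.ncard_coe_finset]
    simp
  rw [hc]
  have := closedNbhdCard_pos (G := G) (P i)
  field_simp

variable (G) in
lemma exists_stepWeight_lower_bound (k : ℕ) : ∃ p : ℝ, 0 < p ∧ p ≤ 1 ∧
    ∀ P Q : Fin k → V, CopStep G P Q → p ≤ stepWeight G P Q := by
  obtain ⟨p, hp, h⟩ : ∃ p : ℝ, 0 < p ∧ ∀ a : {a : (Fin k → V) × (Fin k → V) //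
      CopStep G a.1 a.2}, p ≤ stepWeight G a.1.1 a.1.2 := by
    rcases isEmpty_or_nonempty {a : (Fin k → V) × (Fin k → V) // CopStep G a.1 a.2} with he | he
    · exact ⟨1, one_pos, fun a => he.elim a⟩
    · obtain ⟨a, ha⟩ := Finite.exists_min
        (fun a : {a : (Fin k → V) × (Fin k → V) // CopStep G a.1 a.2} => stepWeight G a.1.1 a.1.2)
      exact ⟨_, stepWeight_pos a.2, ha⟩
  exact ⟨min p 1, lt_min hp one_pos, min_le_right _ _,
    fun P Q hPQ => (min_le_left _ _).trans (h ⟨(P, Q), hPQ⟩)⟩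

variable {ρ : List (Fin k → V) → V}

lemma survProb_eq_zero {n : ℕ} {prev : List (Fin k → V)} {P : Fin k → V}
    (h : HitNow hit ρ prev P) : survProb G hit ρ n prev P = 0 := by
  cases n <;> simp [survProb, h]

lemma survProb_nonneg (n : ℕ) (prev : List (Fin k → V)) (P : Fin k → V) :
    0 ≤ survProb G hit ρ n prev P := by
  induction n generalizing prev P with
  | zero => simp only [survProb]; split_ifs <;> simp
  | succ n ih =>
    simp only [survProb]
    split_ifs
    · rfl
    · exact Finset.sum_nonneg fun Q _ => mul_nonneg (stepWeight_nonneg P Q) (ih _ _)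

lemma survProb_add_le {m : ℕ} {c : ℝ}
    (h : ∀ prev P, survProb G hit ρ m prev P ≤ c) (n : ℕ) (prev : List (Fin k → V))
    (P : Fin k → V) :
    survProb G hit ρ (n + m) prev P ≤ c * survProb G hit ρ n prev P := by
  induction n generalizing prev P with
  | zero =>
    by_cases hh : HitNow hit ρ prev P
    · simp [survProb_eq_zero hh]
    · simpa [survProb, hh] using h prev P
  | succ n ih =>
    by_cases hh : HitNow hit ρ prev P
    · simp [survProb_eq_zero hh]
    · rw [Nat.add_right_comm]
      simp only [survProb, hh, if_false]
      rw [Finset.mul_sum]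
      refine Finset.sum_le_sum fun Q _ => ?_
      rw [mul_left_comm]
      exact mul_le_mul_of_nonneg_left (ih _ _) (stepWeight_nonneg P Q)

lemma survProb_le_one (n : ℕ) (prev : List (Fin k → V)) (P : Fin k → V) :
    survProb G hit ρ n prev P ≤ 1 := by
  induction n generalizing prev P with
  | zero => simp only [survProb]; split_ifs <;> simp
  | succ n ih =>
    simp only [survProb]
    split_ifs
    · exact zero_le_one
    · calc _ ≤ ∑ Q, stepWeight G P Q :=
            Finset.sum_le_sum fun Q _ => mul_le_of_le_one_right (stepWeight_nonneg P Q) (ih _ _)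
        _ = 1 := sum_stepWeight P

lemma survProb_succ_le_of_copStep {n : ℕ} {prev : List (Fin k → V)} {P Q : Fin k → V}
    {p ε : ℝ} (hp : p ≤ stepWeight G P Q) (hε : 0 ≤ ε)
    (h : survProb G hit ρ n (prev ++ [P]) Q ≤ 1 - ε) (hh : ¬ HitNow hit ρ prev P) :
    survProb G hit ρ (n + 1) prev P ≤ 1 - p * ε := by
  simp only [survProb, hh, if_false]
  have h1 : ∀ R, stepWeight G P R * survProb G hit ρ n (prev ++ [P]) R ≤
      stepWeight G P R - if R = Q then stepWeight G P Q * ε else 0 := by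
    intro R
    split_ifs with hR
    · subst hR
      nlinarith [mul_le_mul_of_nonneg_left h (stepWeight_nonneg (G := G) P R)]
    · simpa using mul_le_of_le_one_right (stepWeight_nonneg P R)
        (survProb_le_one (G := G) (hit := hit) (ρ := ρ) n (prev ++ [P]) R)
  calc _ ≤ ∑ R, (stepWeight G P R - if R = Q then stepWeight G P Q * ε else 0) :=
        Finset.sum_le_sum fun R _ => h1 R
    _ = 1 - stepWeight G P Q * ε := by
        rw [Finset.sum_sub_distrib, sum_stepWeight, Finset.sum_ite_eq' Finset.univ Q]
        simp
    _ ≤ _ := by nlinarith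

lemma survProb_le_of_winsIn {p : ℝ} (hp0 : 0 < p) (hp1 : p ≤ 1)
    (hp : ∀ P Q : Fin k → V, CopStep G P Q → p ≤ stepWeight G P Q)
    (hρ : LegalRobberStrat G ρ) (n : ℕ) (prev : List (Fin k → V)) (P : Fin k → V)
    (h : WinsIn G hit n P (ρ (prev ++ [P]))) :
    survProb G hit ρ n prev P ≤ 1 - p ^ n := by
  induction n generalizing prev P with
  | zero => simp [survProb_eq_zero (Or.inl h : HitNow hit ρ prev P)]
  | succ n ih =>
    by_cases hh : HitNow hit ρ prev P
    · rw [survProb_eq_zero hh]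
      exact sub_nonneg.2 (pow_le_one₀ hp0.le hp1)
    rcases h with h | ⟨Q, hQ, h⟩
    · exact absurd (Or.inl h) hh
    rw [pow_succ']
    refine survProb_succ_le_of_copStep (hp P Q hQ) (by positivity) ?_ hh
    rcases h with h | h
    · rw [survProb_eq_zero (Or.inr ⟨by simp, h⟩)]
      exact sub_nonneg.2 (pow_le_one₀ hp0.le hp1)
    · exact ih _ _ (h _ (hρ _ _ (by simp)))

lemma almostSurelyHits_of_forall_wins (hG : G.Connected) {init : Fin k → V}
    (h : ∀ v, Wins G hit init v) : AlmostSurelyHits G hit k := by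
  refine ⟨init, fun ρ hρ => ?_⟩
  obtain ⟨N, hN⟩ := exists_uniform_winsIn (G := G) (hit := hit)
    (fun a : (Fin k → V) × V => a.1) (fun a => a.2)
    (fun a => wins_of_forall_wins hG h a.1 a.2)
  obtain ⟨p, hp0, hp1, hp⟩ := exists_stepWeight_lower_bound G k
  set q := 1 - p ^ (N + 1) with hq
  have hq0 : 0 ≤ q := sub_nonneg.2 (pow_le_one₀ hp0.le hp1)
  have hq1 : q < 1 := sub_lt_self _ (by positivity)
  have hbound : ∀ prev P, survProb G hit ρ (N + 1) prev P ≤ q := fun prev P =>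
    survProb_le_of_winsIn hp0 hp1 hp hρ _ _ _ (winsIn_succ (hN (P, _)))
  have hgeom : ∀ j prev P, survProb G hit ρ ((N + 1) * j) prev P ≤ q ^ j := by
    intro j
    induction j with
    | zero => simpa using survProb_le_one 0
    | succ j ih =>
      intro prev P
      rw [Nat.mul_succ, pow_succ']
      exact (survProb_add_le hbound _ _ _).trans (mul_le_mul_of_nonneg_left (ih _ _) hq0)
  refine squeeze_zero (g := fun n => q ^ (n / (N + 1))) (fun n => survProb_nonneg n [] init)
    (fun n => ?_) ((tendsto_pow_atTop_nhds_zero_of_lt_one hq0 hq1).comp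
      (Nat.tendsto_div_const_atTop N.succ_ne_zero))
  calc survProb G hit ρ n [] init
      = survProb G hit ρ ((N + 1) * (n / (N + 1)) + n % (N + 1)) [] init := by
        rw [Nat.div_add_mod]
    _ ≤ 1 * survProb G hit ρ ((N + 1) * (n / (N + 1))) [] init :=
        survProb_add_le (survProb_le_one _) _ _ _
    _ ≤ _ := by rw [one_mul]; exact hgeom _ _ _

lemma exists_forall_wins_of_almostSurelyHits (h : AlmostSurelyHits G hit k) :
    ∃ init : Fin k → V, ∀ v, Wins G hit init v := by
  obtain ⟨init, hinit⟩ := h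
  refine ⟨init, fun v => by_contra fun hv => ?_⟩
  obtain ⟨g, hg1, hg2⟩ := exists_evasion G hit k
  let ρ : List (Fin k → V) → V := fun L => L.tail.foldl g v
  have happ : ∀ L Q, L ≠ [] → ρ (L ++ [Q]) = g (ρ L) Q := by
    intro L Q hL
    simp only [ρ, List.tail_append_of_ne_nil hL, List.foldl_append]
    rfl
  have hρ : LegalRobberStrat G ρ := fun L Q hL => happ L Q hL ▸ hg1 _ _
  have key : ∀ n prev P, ¬ HitNow hit ρ prev P → ¬ Wins G hit P (ρ (prev ++ [P])) →
      survProb G hit ρ n prev P = 1 := by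
    intro n
    induction n with
    | zero => intro prev P hh _; simp [survProb, hh]
    | succ n ih =>
      intro prev P hh hw
      simp only [survProb, hh, if_false]
      rw [← sum_stepWeight (G := G) P]
      refine Finset.sum_congr rfl fun Q _ => ?_
      by_cases hQ : CopStep G P Q
      · have hw' : ¬ Wins G hit Q (ρ (prev ++ [P] ++ [Q])) := by
          rw [happ _ _ (by simp)]
          exact hg2 _ _ _ hw hQ
        rw [ih _ _ ?_ hw', mul_one]
        rintro (h1 | ⟨-, h1⟩)
        · exact hw' ⟨0, h1⟩
        · exact not_hit_of_copStep hw hQ h1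
      · simp [stepWeight_eq_zero hQ]
  have hone : ∀ n, survProb G hit ρ n [] init = 1 := fun n => by
    refine key n [] init ?_ hv
    rintro (h1 | ⟨h1, -⟩)
    · exact hv ⟨0, h1⟩
    · exact h1 rfl
  have hlim := hinit ρ hρ
  simp only [hone] at hlim
  exact one_ne_zero (tendsto_nhds_unique tendsto_const_nhds hlim)

end Random

/-- For every finite connected simple graph `G` and every
non-negative integer `l`, the eventual seeing number with `l`-visibility cops equals
the `l`-reach number: `evcapt'_l(G) = reach_l(G)`. -/
theorem evSeeNum_eq_reachNum {V : Type} [Fintype V] (G : SimpleGraph V)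
    (hG : G.Connected) (l : ℕ) :
    evSeeNum G l = reachNum G l := by
  unfold evSeeNum reachNum
  congr 1
  ext k
  constructor
  · intro h
    obtain ⟨init, hinit⟩ := exists_forall_wins_of_almostSurelyHits h
    exact copsReach_of_forall_wins hinit
  · intro h
    obtain ⟨init, hinit⟩ := exists_forall_wins_of_copsReach h
    exact almostSurelyHits_of_forall_wins hG hinit
end

section
/- For all positive integers k and l, there exists a finite tree T such that cop'_l(T) - reach_l(T) ≥ k; that is, the gap between the l-visibility seeing number and the l-reach number can be arbitrarily large, even on trees. -/
open Classical

/-- The closed neighbourhood of a finite set of vertices. -/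
noncomputable def closedNbhd {V : Type} [Fintype V] (G : SimpleGraph V) (S : Finset V) :
    Finset V :=
  Finset.univ.filter fun v => ∃ u ∈ S, v = u ∨ G.Adj u v

lemma mem_closedNbhd {V : Type} [Fintype V] {G : SimpleGraph V} {S : Finset V} {v : V} :
    v ∈ closedNbhd G S ↔ ∃ u ∈ S, v = u ∨ G.Adj u v := by
  simp [closedNbhd]

lemma subset_closedNbhd {V : Type} [Fintype V] (G : SimpleGraph V) (S : Finset V) :
    S ⊆ closedNbhd G S := fun v hv => mem_closedNbhd.2 ⟨v, hv, Or.inl rfl⟩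

lemma card_closedNbhd_le {V : Type} [Fintype V] (G : SimpleGraph V) {d : ℕ}
    (hd : ∀ v, (closedNbhd G {v}).card ≤ d) (S : Finset V) :
    (closedNbhd G S).card ≤ S.card * d := by
  have h : closedNbhd G S ⊆ S.biUnion fun v => closedNbhd G {v} := by
    intro v hv
    obtain ⟨u, hu, huv⟩ := mem_closedNbhd.1 hv
    exact Finset.mem_biUnion.2 ⟨u, hu, mem_closedNbhd.2 ⟨u, by simp, huv⟩⟩
  exact (Finset.card_le_card h).trans (Finset.card_biUnion_le_card_mul _ _ _ fun v _ => hd v)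

lemma card_iterate_closedNbhd_le {V : Type} [Fintype V] (G : SimpleGraph V) {d : ℕ}
    (hd : ∀ v, (closedNbhd G {v}).card ≤ d) (c : V) (l : ℕ) :
    ((closedNbhd G)^[l] {c}).card ≤ d ^ l := by
  induction l with
  | zero => simp
  | succ l ih =>
    rw [Function.iterate_succ_apply', pow_succ]
    exact (card_closedNbhd_le G hd _).trans (Nat.mul_le_mul_right d ih)

lemma mem_iterate_closedNbhd_of_walk {V : Type} [Fintype V] {G : SimpleGraph V} {c v : V}
    (p : G.Walk c v) : ∀ {S : Finset V}, c ∈ S → ∀ {l : ℕ}, p.length ≤ l →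
      v ∈ (closedNbhd G)^[l] S := by
  induction p with
  | nil =>
    intro S hc l _
    induction l with
    | zero => exact hc
    | succ l ih =>
      rw [Function.iterate_succ_apply']
      exact subset_closedNbhd G _ (ih (Nat.zero_le _))
  | cons h p ih =>
    intro S hc l hl
    cases l with
    | zero => simp at hl
    | succ l =>
      rw [Function.iterate_succ_apply]
      exact ih (mem_closedNbhd.2 ⟨_, hc, Or.inr h⟩) (by simpa using hl)

lemma mem_iterate_closedNbhd_of_inSight {V : Type} [Fintype V] {G : SimpleGraph V} {l : ℕ}
    {c v : V} (h : inSight G l c v) : v ∈ (closedNbhd G)^[l] {c} := by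
  obtain ⟨p, hp⟩ := h.1.exists_walk_length_eq_dist
  exact mem_iterate_closedNbhd_of_walk p (Finset.mem_singleton_self c) (hp ▸ h.2)

/-- Compactness: a robber that can avoid the forbidden sets for any finite time can avoid them
forever. -/
lemma exists_evading_of_finite {V : Type} [Finite V] (G : SimpleGraph V) (Z : ℕ → Finset V)
    (h : ∀ n, ∃ r, LegalRobber G r ∧ ∀ t ≤ n, r t ∉ Z t) :
    ∃ r, LegalRobber G r ∧ ∀ t, r t ∉ Z t := by
  let τ : TopologicalSpace V := ⊥
  have : DiscreteTopology V := ⟨rfl⟩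
  let C : ℕ → Set (ℕ → V) := fun n => {r | LegalRobber G r ∧ ∀ t ≤ n, r t ∉ Z t}
  have hclosed : ∀ n, IsClosed (C n) := by
    intro n
    have : C n = (⋂ t, (fun r : ℕ → V => (r t, r (t + 1))) ⁻¹' {p | p.2 = p.1 ∨ G.Adj p.1 p.2}) ∩
        ⋂ t, ⋂ (_ : t ≤ n), (fun r : ℕ → V => r t) ⁻¹' {v | v ∉ Z t} := by
      ext r; simp [C, LegalRobber]
    rw [this]
    refine (isClosed_iInter fun t => ?_).inter
      (isClosed_iInter fun t => isClosed_iInter fun _ => ?_)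
    · exact (isClosed_discrete _).preimage (by fun_prop)
    · exact (isClosed_discrete _).preimage (by fun_prop)
  obtain ⟨r, hr⟩ := IsCompact.nonempty_iInter_of_sequence_nonempty_isCompact_isClosed C
    (fun n r hr => ⟨hr.1, fun t ht => hr.2 t (by omega)⟩) h (hclosed 0).isCompact hclosed
  rw [Set.mem_iInter] at hr
  exact ⟨r, (hr 0).1, fun t => (hr t).2 t le_rfl⟩

/-- If every set of vertices whose size lies in the window `[a, a + z)` has at least `z` outer
neighbours, then the robber can evade any sequence of forbidden sets of size at most `z`. -/
lemma exists_evading {V : Type} [Fintype V] (G : SimpleGraph V) {Z : ℕ → Finset V} {z a : ℕ}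
    (hZ : ∀ t, (Z t).card ≤ z) (ha : 0 < a) (hcard : a + z ≤ Fintype.card V)
    (hiso : ∀ S : Finset V, a ≤ S.card → S.card < a + z → S.card + z ≤ (closedNbhd G S).card) :
    ∃ r, LegalRobber G r ∧ ∀ t, r t ∉ Z t := by
  apply exists_evading_of_finite
  suffices H : ∀ n, ∃ S : Finset V, a ≤ S.card ∧
      ∀ v ∈ S, ∃ r, LegalRobber G r ∧ r n = v ∧ ∀ t ≤ n, r t ∉ Z t by
    intro n
    obtain ⟨S, hS, h⟩ := H n
    obtain ⟨v, hv⟩ := Finset.card_pos.1 (ha.trans_le hS)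
    obtain ⟨r, hr, -, hr'⟩ := h v hv
    exact ⟨r, hr, hr'⟩
  intro n
  induction n with
  | zero =>
    refine ⟨Finset.univ \ Z 0, ?_, fun v hv => ⟨fun _ => v, fun _ => Or.inl rfl, rfl, ?_⟩⟩
    · have := Finset.le_card_sdiff (Z 0) Finset.univ
      have := hZ 0
      rw [Finset.card_univ] at *
      omega
    · rintro t ht
      obtain rfl : t = 0 := by omega
      simpa using hv
  | succ n ih =>
    obtain ⟨S, hS, h⟩ := ih
    refine ⟨closedNbhd G S \ Z (n + 1), ?_, fun v hv => ?_⟩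
    · have h1 := Finset.le_card_sdiff (Z (n + 1)) (closedNbhd G S)
      have h2 := hZ (n + 1)
      have h3 := Finset.card_le_card (subset_closedNbhd G S)
      by_cases hlt : S.card < a + z
      · have := hiso S hS hlt
        omega
      · omega
    · rw [Finset.mem_sdiff, mem_closedNbhd] at hv
      obtain ⟨⟨u, hu, huv⟩, hvZ⟩ := hv
      obtain ⟨r, hr, hrn, hrZ⟩ := h u hu
      refine ⟨fun t => if t ≤ n then r t else v, ?_, by simp, ?_⟩
      · intro t
        rcases lt_trichotomy t n with ht | rfl | ht
        · have h1 : t + 1 ≤ n := ht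
          simpa [h1, ht.le] using hr t
        · simpa [hrn] using huv
        · have h1 : ¬ t + 1 ≤ n := by omega
          have h2 : ¬ t ≤ n := by omega
          simp [h1, h2]
      · intro t ht
        by_cases htn : t ≤ n
        · simpa [htn] using hrZ t htn
        · obtain rfl : t = n + 1 := by omega
          simpa using hvZ

/-- Against a robber that stays out of sight of the cop positions prescribed for blind play, the
cops follow exactly these positions. -/
lemma visPlay_eq_of_unseen {V : Type} (G : SimpleGraph V) (l : ℕ) {k : ℕ} (init : Fin k → V)
    (σ : List (Option V) → Fin k → V) (r : ℕ → V) (P : ℕ → Fin k → V) (hP0 : P 0 = init)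
    (hP : ∀ t, P (t + 1) = σ (List.replicate (t + 1) none))
    (h : ∀ t i, ¬ inSight G l (P t i) (r t)) (t : ℕ) :
    visPlay G l init σ r t = (P t, List.replicate t none) := by
  induction t with
  | zero => simp [visPlay, hP0]
  | succ t ih =>
    have h' : ¬ ∃ i, inSight G l (P t i) (r t) := by simpa using h t
    simp [visPlay, ih, visObs, h', hP, List.replicate_succ']

lemma not_visCopsSee {V : Type} [Fintype V] (G : SimpleGraph V) {l d k z a : ℕ}
    (hd : ∀ v, (closedNbhd G {v}).card ≤ d) (hz : 2 * k * d ^ l ≤ z) (ha : 0 < a)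
    (hcard : a + z ≤ Fintype.card V)
    (hiso : ∀ S : Finset V, a ≤ S.card → S.card < a + z →
      S.card + z ≤ (closedNbhd G S).card) :
    ¬ VisCopsSee G l k := by
  rintro ⟨init, σ, H⟩
  let P : ℕ → Fin k → V := fun t => if t = 0 then init else σ (List.replicate t none)
  let B : ℕ → Finset V := fun t => Finset.univ.biUnion fun i => (closedNbhd G)^[l] {P t i}
  have hB : ∀ t, (B t).card ≤ k * d ^ l := fun t => by
    simpa using Finset.card_biUnion_le_card_mul Finset.univ
      (fun i => (closedNbhd G)^[l] {P t i}) (d ^ l)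
      fun i _ => card_iterate_closedNbhd_le G hd (P t i) l
  have hBmem : ∀ {t i v}, inSight G l (P t i) v → v ∈ B t := fun {t i v} h =>
    Finset.mem_biUnion.2 ⟨i, Finset.mem_univ i, mem_iterate_closedNbhd_of_inSight h⟩
  obtain ⟨r, hr, hrB⟩ := exists_evading G (Z := fun t => B t ∪ B (t + 1)) (z := z) (fun t => by
    have h1 := Finset.card_union_le (B t) (B (t + 1))
    have h2 := hB t
    have h3 := hB (t + 1)
    have h4 : 2 * k * d ^ l = k * d ^ l + k * d ^ l := by ring
    change (B t ∪ B (t + 1)).card ≤ z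
    omega) ha hcard hiso
  have hplay := visPlay_eq_of_unseen G l init σ r P (by simp [P]) (fun t => by simp [P])
    fun t i hs => hrB t (Finset.mem_union_left _ (hBmem hs))
  have hpos : ∀ t, visPos G l init σ r t = P t := fun t => by simp [visPos, hplay]
  obtain ⟨-, t, i, hs | hs⟩ := H r hr
  · exact hrB t (Finset.mem_union_left _ (hBmem (hpos t ▸ hs)))
  · exact hrB t (Finset.mem_union_right _ (hBmem (hpos (t + 1) ▸ hs)))

lemma exists_visCopsSee {V : Type} [Fintype V] (G : SimpleGraph V) (l : ℕ) :
    ∃ k, VisCopsSee G l k := by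
  let e := (Fintype.equivFin V).symm
  refine ⟨Fintype.card V, e, fun _ => e, fun r _ => ?_⟩
  have hpos : ∀ t, visPos G l e (fun _ => e) r t = e := by
    intro t
    cases t <;> simp [visPos, visPlay]
  refine ⟨fun t i => Or.inl (by simp [hpos]), 0, e.symm (r 0), Or.inl ?_⟩
  simp [hpos, inSight]

/-- The vertices of the complete binary tree of height `h`: binary words of length at most `h`. -/
abbrev BinWord (h : ℕ) : Type := {s : List Bool // s.length ≤ h}

noncomputable instance (h : ℕ) : Fintype (BinWord h) :=
  (List.finite_length_le Bool h).fintype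

/-- The root of the complete binary tree. -/
def BinWord.root (h : ℕ) : BinWord h := ⟨[], Nat.zero_le h⟩

/-- The parent of a vertex of the complete binary tree; the root is its own parent. -/
def BinWord.parent {h : ℕ} (v : BinWord h) : BinWord h :=
  ⟨v.1.tail, by have := v.2; simp only [List.length_tail]; omega⟩

/-- The complete binary tree of height `h`. -/
def binTree (h : ℕ) : SimpleGraph (BinWord h) where
  Adj u v := ∃ b, v.1 = b :: u.1 ∨ u.1 = b :: v.1
  symm := ⟨fun _ _ ⟨b, hb⟩ => ⟨b, hb.symm⟩⟩
  loopless := ⟨by rintro v ⟨b, hb | hb⟩ <;> simpa using congrArg List.length hb⟩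

lemma BinWord.ne_root_iff {h : ℕ} {v : BinWord h} : v ≠ root h ↔ v.1 ≠ [] := by
  rw [Ne, Subtype.ext_iff]; rfl

lemma binTree_adj_parent {h : ℕ} {v : BinWord h} (hv : v ≠ BinWord.root h) :
    (binTree h).Adj v.parent v :=
  ⟨v.1.head (BinWord.ne_root_iff.1 hv), Or.inl (by simp [BinWord.parent])⟩

lemma binTree_adj_iff {h : ℕ} {u v : BinWord h} :
    (binTree h).Adj u v ↔ (v ≠ .root h ∧ u = v.parent) ∨ (u ≠ .root h ∧ v = u.parent) := by
  constructor
  · rintro ⟨b, hb | hb⟩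
    · exact Or.inl ⟨BinWord.ne_root_iff.2 (by simp [hb]), Subtype.ext (by simp [BinWord.parent, hb])⟩
    · exact Or.inr ⟨BinWord.ne_root_iff.2 (by simp [hb]), Subtype.ext (by simp [BinWord.parent, hb])⟩
  · rintro (⟨hv, rfl⟩ | ⟨hu, rfl⟩)
    · exact binTree_adj_parent hv
    · exact (binTree_adj_parent hu).symm

lemma binTree_reachable_root {h : ℕ} (v : BinWord h) :
    (binTree h).Reachable (BinWord.root h) v := by
  obtain ⟨s, hs⟩ := v
  induction s with
  | nil => exact SimpleGraph.Reachable.refl _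
  | cons b s ih =>
    have hs' : s.length ≤ h := by simp at hs; omega
    exact (ih hs').trans (SimpleGraph.Adj.reachable ⟨b, Or.inl rfl⟩)

lemma binTree_isTree (h : ℕ) : (binTree h).IsTree := by
  have hc : (binTree h).Connected := by
    have : Nonempty (BinWord h) := ⟨BinWord.root h⟩
    exact ⟨fun u v => (binTree_reachable_root u).symm.trans (binTree_reachable_root v)⟩
  refine SimpleGraph.isTree_iff_connected_and_card.2
    ⟨hc, le_antisymm ?_ hc.card_vert_le_card_edgeSet_add_one⟩
  have hsub : (binTree h).edgeSet ⊆
      (fun v : BinWord h => s(v.parent, v)) '' {v | v ≠ BinWord.root h} := by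
    intro e he
    induction e with
    | h u v =>
      rw [SimpleGraph.mem_edgeSet, binTree_adj_iff] at he
      rcases he with ⟨hv, rfl⟩ | ⟨hu, rfl⟩
      · exact ⟨v, hv, rfl⟩
      · exact ⟨u, hu, Sym2.eq_swap⟩
  have h1 : (binTree h).edgeSet.ncard ≤ {v | v ≠ BinWord.root h}.ncard :=
    (Set.ncard_le_ncard hsub).trans (Set.ncard_image_le (Set.toFinite _))
  have h2 : {v | v ≠ BinWord.root h} = {BinWord.root h}ᶜ := rfl
  have h3 := Set.ncard_add_ncard_compl {BinWord.root h}
  rw [Set.ncard_singleton] at h3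
  rw [h2] at h1
  rw [Nat.card_coe_set_eq]
  omega

lemma card_closedNbhd_binTree_le {h : ℕ} (v : BinWord h) :
    (closedNbhd (binTree h) {v}).card ≤ 4 := by
  rw [← Finset.card_map (Function.Embedding.subtype _)]
  have : (closedNbhd (binTree h) {v}).map (Function.Embedding.subtype _) ⊆
      {v.1, v.1.tail, true :: v.1, false :: v.1} := by
    intro s hs
    simp only [Finset.mem_map, mem_closedNbhd, Finset.mem_singleton] at hs
    obtain ⟨w, ⟨_, rfl, rfl | ⟨b, hb | hb⟩⟩, rfl⟩ := hs
    · simp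
    · cases b <;> simp [hb]
    · simp [hb]
  exact (Finset.card_le_card this).trans Finset.card_le_four

lemma two_pow_le_card_binWord (h : ℕ) : 2 ^ h ≤ Fintype.card (BinWord h) := by
  have := Fintype.card_le_of_injective (α := Fin h → Bool) (β := BinWord h)
    (fun f => ⟨List.ofFn f, by simp⟩) fun f g hfg => by
      simpa using congrArg Subtype.val hfg
  simpa using this

/-- The move of a single cop at `c` chasing a robber at `v`: descend towards `v` if `v` lies
strictly below `c`, and stay put otherwise. -/
noncomputable def BinWord.descend {h : ℕ} (c v : BinWord h) : BinWord h :=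
  if c.1 <:+ v.1 ∧ c ≠ v then
    ⟨v.1.drop (v.1.length - c.1.length - 1), by have := v.2; simp only [List.length_drop]; omega⟩
  else c

lemma BinWord.length_lt_of_suffix {h : ℕ} {c v : BinWord h} (hs : c.1 <:+ v.1) (hne : c ≠ v) :
    c.1.length < v.1.length :=
  lt_of_le_of_ne hs.length_le fun hl => hne (Subtype.ext (hs.eq_of_length hl))

lemma BinWord.descend_spec {h : ℕ} {c v : BinWord h} (hs : c.1 <:+ v.1) (hne : c ≠ v) :
    (c.descend v).1 <:+ v.1 ∧ (c.descend v).1.length = c.1.length + 1 := by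
  have hlt := length_lt_of_suffix hs hne
  rw [descend, if_pos ⟨hs, hne⟩]
  exact ⟨List.drop_suffix _ _, by simp only [List.length_drop]; omega⟩

lemma BinWord.descend_legal {h : ℕ} (c v : BinWord h) :
    c.descend v = c ∨ (binTree h).Adj c (c.descend v) := by
  by_cases hcv : c.1 <:+ v.1 ∧ c ≠ v
  · obtain ⟨h1, h2⟩ := descend_spec hcv.1 hcv.2
    obtain ⟨w, hw⟩ := List.suffix_of_suffix_length_le hcv.1 h1 (by omega)
    refine Or.inr ?_
    have hl := congrArg List.length hw
    rw [List.length_append, h2] at hl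
    obtain ⟨b, rfl⟩ := List.length_eq_one_iff.1 (show w.length = 1 by omega)
    exact ⟨b, Or.inl hw.symm⟩
  · exact Or.inl (if_neg hcv)

lemma reachNum_binTree_le_one (h l : ℕ) : reachNum (binTree h) l ≤ 1 := by
  refine Nat.sInf_le ⟨fun _ => .root h, fun L _ => L.foldl BinWord.descend (.root h),
    fun r hr => ?_⟩
  set P := fullPos (fun _ : Fin 1 => BinWord.root h)
    (fun L _ => L.foldl BinWord.descend (.root h)) r with hP
  have hfold : ∀ t i, P t i =
      (List.ofFn fun j : Fin t => r j.1).foldl BinWord.descend (.root h) := by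
    intro t i
    cases t <;> simp [hP, fullPos]
  have hsucc : ∀ t i, P (t + 1) i = (P t i).descend (r t) := by
    intro t i
    rw [hfold, hfold, List.ofFn_succ']
    simp [List.foldl_append]
  refine ⟨fun t i => hsucc t i ▸ BinWord.descend_legal (P t i) (r t), ?_⟩
  by_contra! hfree
  have hne : ∀ t, P t 0 ≠ r t ∧ P (t + 1) 0 ≠ r t := fun t =>
    ⟨fun he => (hfree t 0).1 (by simp [inSight, he]),
      fun he => (hfree t 0).2 (by simp [inSight, he])⟩
  have key : ∀ t, (P t 0).1 <:+ (r t).1 ∧ (P t 0).1.length = t := by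
    intro t
    induction t with
    | zero => simp [hP, fullPos, BinWord.root]
    | succ t ih =>
      obtain ⟨h1, h2⟩ := BinWord.descend_spec ih.1 (hne t).1
      rw [← hsucc] at h1 h2
      refine ⟨?_, by omega⟩
      have hlt := BinWord.length_lt_of_suffix h1 (hne t).2
      rcases hr t with he | ⟨b, hb | hb⟩
      · rwa [he]
      · exact hb ▸ h1.trans (List.suffix_cons b _)
      · rw [hb] at h1 hlt
        rcases List.suffix_cons_iff.1 h1 with he | hs
        · rw [he] at hlt
          exact absurd hlt (lt_irrefl _)
        · exact hs
  have h1 := (key (h + 1)).2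
  have h2 := (P (h + 1) 0).2
  omega

/-- The number of vertices of the subtree hanging below a vertex of depth `d` in the complete
binary tree of height `h`. -/
def subtreeSize (h d : ℕ) : ℤ := 2 ^ (h + 1 - d) - 1

lemma two_mul_subtreeSize_succ_add_one {h d : ℕ} (hd : d ≤ h) :
    2 * subtreeSize h (d + 1) + 1 = subtreeSize h d := by
  have : h + 1 - d = (h + 1 - (d + 1)) + 1 := by omega
  rw [subtreeSize, subtreeSize, this, pow_succ]
  ring

lemma sum_children_subtreeSize {h : ℕ} (u : BinWord h) :
    ∑ v : BinWord h with v ≠ .root h ∧ v.parent = u, subtreeSize h v.1.length =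
      2 * subtreeSize h (u.1.length + 1) := by
  by_cases hu : u.1.length < h
  · have : ({v : BinWord h | v ≠ .root h ∧ v.parent = u} : Finset (BinWord h)) =
        {⟨true :: u.1, hu⟩, ⟨false :: u.1, hu⟩} := by
      ext v
      obtain ⟨s, hs⟩ := v
      rcases s with _ | ⟨b, s⟩
      · simp [BinWord.root, Subtype.ext_iff]
      · cases b <;> simp [BinWord.root, BinWord.parent, Subtype.ext_iff]
    rw [this, Finset.sum_pair (by simp [Subtype.ext_iff])]
    simp [two_mul]
  · have hul : u.1.length = h := le_antisymm u.2 (not_lt.1 hu)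
    rw [Finset.sum_eq_zero, hul]
    · simp [subtreeSize]
    · intro v hv
      obtain ⟨hroot, rfl⟩ := (Finset.mem_filter.1 hv).2
      have h1 := v.2
      have h2 := List.length_pos_iff.2 (BinWord.ne_root_iff.1 hroot)
      simp only [BinWord.parent, List.length_tail] at hul
      omega

lemma sum_eq_sum_sub_parent {h : ℕ} (x : BinWord h → ℤ) :
    ∑ v, x v = ∑ v, (if v = .root h then x v else x v - x v.parent) *
      subtreeSize h v.1.length := by
  have h1 : ∑ v : BinWord h with v ≠ .root h, x v.parent * subtreeSize h v.1.length =
      ∑ u : BinWord h, x u * (2 * subtreeSize h (u.1.length + 1)) := by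
    rw [← Finset.sum_fiberwise _ BinWord.parent]
    refine Finset.sum_congr rfl fun u _ => ?_
    rw [← sum_children_subtreeSize, Finset.mul_sum, Finset.filter_filter]
    refine Finset.sum_congr rfl fun v hv => ?_
    rw [(Finset.mem_filter.1 hv).2.2]
  have h2 : ∀ v : BinWord h,
      (if v = .root h then x v else x v - x v.parent) * subtreeSize h v.1.length =
      x v * subtreeSize h v.1.length -
        if v ≠ .root h then x v.parent * subtreeSize h v.1.length else 0 := by
    intro v
    by_cases hv : v = .root h <;> simp [hv, sub_mul]
  rw [Finset.sum_congr rfl fun v _ => h2 v, Finset.sum_sub_distrib, ← Finset.sum_filter, h1,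
    ← Finset.sum_sub_distrib]
  refine Finset.sum_congr rfl fun v _ => ?_
  rw [← two_mul_subtreeSize_succ_add_one v.2]
  ring

lemma exists_fin_sum_eq {ι α : Type} [Fintype ι] (val : Option α → ℤ) (hval : val none = 0)
    (t : ι → Option α) {m : ℕ} (hm : (Finset.univ.filter fun i => t i ≠ none).card ≤ m) :
    ∃ f : Fin m → Option α, ∑ j, val (f j) = ∑ i, val (t i) := by
  obtain ⟨e⟩ : Nonempty ({i // t i ≠ none} ↪ Fin m) :=
    Function.Embedding.nonempty_of_card_le (by simpa [Fintype.card_subtype] using hm)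
  refine ⟨Function.extend e (fun i => t i) fun _ => none, ?_⟩
  rw [← Fintype.sum_of_injective e e.injective (fun i => val (t i)) _
    (fun j hj => by rw [Function.extend_apply' _ _ _ (by simpa using hj), hval])
    (fun i => by rw [e.injective.extend_apply])]
  exact Fintype.sum_of_injective Subtype.val Subtype.val_injective _ _
    (fun i hi => by
      have hi' : t i = none := by simpa using hi
      rw [hi', hval])
    fun _ => rfl

/-- The signed subtree sizes, together with `0`. -/
def signedSubtreeSize (h : ℕ) : Option (Bool × Fin (h + 1)) → ℤ
  | none => 0
  | some (true, d) => subtreeSize h d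
  | some (false, d) => -subtreeSize h d

/-- The size of a set of vertices of the binary tree with few outer neighbours is a short sum of
signed subtree sizes. -/
lemma exists_card_eq_sum {h z : ℕ} (S : Finset (BinWord h))
    (hS : (closedNbhd (binTree h) S).card < S.card + z) :
    ∃ f : Fin (4 * z) → Option (Bool × Fin (h + 1)),
      ∑ j, signedSubtreeSize h (f j) = S.card := by
  let t : BinWord h → Option (Bool × Fin (h + 1)) := fun v =>
    if v = .root h then if v ∈ S then some (true, ⟨v.1.length, Nat.lt_succ_of_le v.2⟩) else none
    else if (v ∈ S ↔ v.parent ∈ S) then none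
    else some (decide (v ∈ S), ⟨v.1.length, Nat.lt_succ_of_le v.2⟩)
  let D := closedNbhd (binTree h) S \ S
  have hD : D.card + 1 ≤ z := by
    have := Finset.card_sdiff_add_card_eq_card (subset_closedNbhd (binTree h) S)
    simp only [D]
    omega
  have hsupp : (Finset.univ.filter fun v => t v ≠ none) ⊆
      insert (.root h) (closedNbhd (binTree h) D) := by
    intro v hv
    rw [Finset.mem_insert]
    by_cases hroot : v = .root h
    · exact Or.inl hroot
    refine Or.inr ?_
    have hadj := binTree_adj_parent hroot
    have hcut : ¬ (v ∈ S ↔ v.parent ∈ S) := fun hc => by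
      simp [t, hroot, hc] at hv
    by_cases hvS : v ∈ S
    · have hp : v.parent ∉ S := fun hp => hcut ⟨fun _ => hp, fun _ => hvS⟩
      exact mem_closedNbhd.2 ⟨v.parent, Finset.mem_sdiff.2
        ⟨mem_closedNbhd.2 ⟨v, hvS, Or.inr hadj.symm⟩, hp⟩, Or.inr hadj⟩
    · have hp : v.parent ∈ S := by tauto
      exact subset_closedNbhd _ _ (Finset.mem_sdiff.2
        ⟨mem_closedNbhd.2 ⟨v.parent, hp, Or.inr hadj⟩, hvS⟩)
  obtain ⟨f, hf⟩ := exists_fin_sum_eq (signedSubtreeSize h) rfl t (m := 4 * z) (by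
    have h1 := Finset.card_le_card hsupp
    have h2 := Finset.card_insert_le (BinWord.root h) (closedNbhd (binTree h) D)
    have h3 := card_closedNbhd_le (binTree h) card_closedNbhd_binTree_le D
    omega)
  refine ⟨f, ?_⟩
  have hsum := sum_eq_sum_sub_parent fun v : BinWord h => if v ∈ S then (1 : ℤ) else 0
  rw [hf, Finset.card_eq_sum_ones, Nat.cast_sum]
  simp only [Finset.sum_ite_mem, Finset.univ_inter] at hsum
  push_cast
  rw [hsum]
  refine Finset.sum_congr rfl fun v _ => ?_
  by_cases hroot : v = .root h
  · by_cases hv : v ∈ S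
    · subst hroot
      simp [t, hv, signedSubtreeSize]
    · subst hroot
      simp [t, hv, signedSubtreeSize]
  · by_cases hv : v ∈ S <;> by_cases hp : v.parent ∈ S <;>
      simp [t, hroot, hv, hp, signedSubtreeSize]

lemma exists_isoperimetric_window {h z : ℕ} (hz : 0 < z) :
    ∃ a, 0 < a ∧ a ≤ (2 * h + 3) ^ (4 * z) * z + 1 ∧
      ∀ S : Finset (BinWord h), a ≤ S.card → S.card < a + z →
        S.card + z ≤ (closedNbhd (binTree h) S).card := by
  by_contra! hcon
  have H : ∀ i : Fin ((2 * h + 3) ^ (4 * z) + 1),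
      ∃ f : Fin (4 * z) → Option (Bool × Fin (h + 1)), ∃ s : ℕ,
        ∑ j, signedSubtreeSize h (f j) = s ∧ (s - 1) / z = i := by
    intro i
    obtain ⟨S, h1, h2, h3⟩ := hcon (i * z + 1) (Nat.succ_pos _)
      (Nat.succ_le_succ (Nat.mul_le_mul_right z (Nat.lt_succ_iff.1 i.2)))
    obtain ⟨f, hf⟩ := exists_card_eq_sum S h3
    refine ⟨f, S.card, hf, ?_⟩
    rw [Nat.div_eq_iff hz]
    omega
  choose f s hs hi using H
  have hinj : Function.Injective f := fun i j hij => by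
    have : (s i : ℤ) = s j := by rw [← hs, ← hs, hij]
    exact Fin.ext (by rw [← hi i, ← hi j, Nat.cast_injective this])
  have := Fintype.card_le_of_injective f hinj
  simp only [Fintype.card_fin, Fintype.card_fun, Fintype.card_option, Fintype.card_prod,
    Fintype.card_bool] at this
  rw [show 2 * (h + 1) + 1 = 2 * h + 3 by ring] at this
  omega

lemma exists_height (m z : ℕ) : ∃ h : ℕ, (2 * h + 3) ^ m * z + 1 + z ≤ 2 ^ h := by
  have ht := tendsto_pow_const_div_const_pow_of_one_lt m (one_lt_two (α := ℝ))
  have hpos : (0 : ℝ) < 1 / (5 ^ m * (2 * z + 1)) := by positivity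
  obtain ⟨h, hh, h1⟩ := ((ht.eventually (gt_mem_nhds hpos)).and
    (Filter.eventually_ge_atTop 1)).exists
  refine ⟨h, ?_⟩
  rw [div_lt_div_iff₀ (by positivity) (by positivity), one_mul] at hh
  have hh' : h ^ m * (5 ^ m * (2 * z + 1)) < 2 ^ h := by exact_mod_cast hh
  have h2 : (2 * h + 3) ^ m ≤ 5 ^ m * h ^ m := by
    rw [← mul_pow]
    exact Nat.pow_le_pow_left (by omega) m
  have h3 : 1 ≤ 5 ^ m * h ^ m := Nat.one_le_iff_ne_zero.2 (by positivity)
  nlinarith [Nat.mul_le_mul_right z h2, Nat.mul_le_mul_right z h3]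

/-- For all positive integers `k` and `l`, there exists a finite
tree `T` such that `cop'_l(T) - reach_l(T) ≥ k`: the gap between the `l`-visibility
seeing number and the `l`-reach number can be arbitrarily large, even on trees. -/
theorem seeing_minus_reach_arbitrarily_large_on_trees (k l : ℕ) (hk : 0 < k)
    (hl : 0 < l) :
    ∃ (V : Type) (_ : Fintype V) (T : SimpleGraph V),
      T.IsTree ∧ reachNum T l + k ≤ visSeeNum T l := by
  have hz : 0 < 2 * k * 4 ^ l := by positivity
  obtain ⟨h, hh⟩ := exists_height (4 * (2 * k * 4 ^ l)) (2 * k * 4 ^ l)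
  refine ⟨BinWord h, inferInstance, binTree h, binTree_isTree h, ?_⟩
  obtain ⟨a, ha, hle, hiso⟩ := exists_isoperimetric_window (h := h) hz
  have hcard := two_pow_le_card_binWord h
  have hsee : visSeeNum (binTree h) l ∈ {j | VisCopsSee (binTree h) l j} :=
    Nat.sInf_mem (exists_visCopsSee (binTree h) l)
  have hlt : k < visSeeNum (binTree h) l := by
    by_contra! hle'
    exact not_visCopsSee (binTree h) card_closedNbhd_binTree_le
      (Nat.mul_le_mul_right _ (Nat.mul_le_mul_left 2 hle')) ha (by omega) hiso hsee
  have := reachNum_binTree_le_one h l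
  omega
end
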